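/- Fix ω > 0, ρ > 0, μ > 0, λ + 2μ > 0, and x ∈ ℝ³∖{0}. For each radius a with 0 < a < |x|, let U_a be the displacement tensor in the perfectly bonded case Z_S = Z_T, with all impedances and Z (via the lumped formula) depending on a. Then lim_{a→0⁺} a^{−1} U_a(x) = (12πμ/(2 + κ^{−2})) G⁰(x), where κ^{−2} = μ/(λ+2μ) and G⁰ is the free-space elastodynamic Green's tensor. (This is the small-inclusion limit U = iω Z G⁰ + o(a), since iω Z ∼ 12πaμ/(2+κ^{−2}) as a → 0.) -/

import Mathlib

open Complex Matrix Filter Topology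

/-- Outer product matrix `r̂ ⊗ r̂` (complexified) of the unit radial direction of `x`. -/
noncomputable def outerUnit (x : EuclideanSpace ℝ (Fin 3)) : Matrix (Fin 3) (Fin 3) ℂ :=
  Matrix.of fun i j => (((x i / ‖x‖) * (x j / ‖x‖) : ℝ) : ℂ)

/-- The displacement tensor `U(r)` of a spherical inclusion, Eq. (471) of the paper. -/
noncomputable def Udisp (a k h : ℝ) (Z ZM ZL ZS ZT : ℂ)
    (x : EuclideanSpace ℝ (Fin 3)) : Matrix (Fin 3) (Fin 3) ℂ :=
  ((Z + ZM) * ((a : ℂ) / (‖x‖ : ℂ))) •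
    ((Complex.exp (I * k * ((‖x‖ : ℝ) - a)) / (ZL + ZM)) •
        ((1 / ((k : ℂ) * ‖x‖) ^ 2 - I / ((k : ℂ) * ‖x‖)) • (1 : Matrix (Fin 3) (Fin 3) ℂ)
          + (1 + 3 * I / ((k : ℂ) * ‖x‖) - 3 / ((k : ℂ) * ‖x‖) ^ 2) • outerUnit x)
      + (ZS / ZT * Complex.exp (I * h * ((‖x‖ : ℝ) - a)) / (ZS + ZM)) •
        ((1 + I / ((h : ℂ) * ‖x‖) - 1 / ((h : ℂ) * ‖x‖) ^ 2) • (1 : Matrix (Fin 3) (Fin 3) ℂ)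
          - (1 + 3 * I / ((h : ℂ) * ‖x‖) - 3 / ((h : ℂ) * ‖x‖) ^ 2) • outerUnit x))

/-- The free-space elastodynamic Green's tensor `G⁰(r)`, Eq. (92) of the paper. -/
noncomputable def Green0 (k h mu : ℝ) (x : EuclideanSpace ℝ (Fin 3)) :
    Matrix (Fin 3) (Fin 3) ℂ :=
  let f : EuclideanSpace ℝ (Fin 3) → ℂ := fun y =>
    (Complex.exp (I * h * (‖y‖ : ℝ)) - Complex.exp (I * k * (‖y‖ : ℝ)))
      / ((h : ℂ) ^ 2 * (‖y‖ : ℂ))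
  let Hess : Matrix (Fin 3) (Fin 3) ℂ := Matrix.of fun i j =>
    fderiv ℝ (fun y => fderiv ℝ f y (EuclideanSpace.single j 1)) x (EuclideanSpace.single i 1)
  ((1 : ℂ) / (4 * Real.pi * mu)) •
    ((Complex.exp (I * h * (‖x‖ : ℝ)) / (‖x‖ : ℂ)) • (1 : Matrix (Fin 3) (Fin 3) ℂ) + Hess)

/-- Mass-like impedance `Z_M = iω(4/3)πa³ρ`. -/
noncomputable def ZMf (a ρ ω : ℝ) : ℂ := I * ω * (4 / 3) * Real.pi * a ^ 3 * ρ

/-- Longitudinal impedance `Z_L = (iω)⁻¹ 4πa(λ+2μ)(1−ika)`, `k = ω/c_L`. -/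
noncomputable def ZLf (a ρ lam mu ω : ℝ) : ℂ :=
  (I * ω)⁻¹ * (4 * Real.pi * a * (lam + 2 * mu))
    * (1 - I * (ω / Real.sqrt ((lam + 2 * mu) / ρ)) * a)

/-- Transverse impedance `Z_T = (iω)⁻¹ 4πaμ(1−iha)`, `h = ω/c_T`. -/
noncomputable def ZTf (a ρ mu ω : ℝ) : ℂ :=
  (I * ω)⁻¹ * (4 * Real.pi * a * mu) * (1 - I * (ω / Real.sqrt (mu / ρ)) * a)

/-- The sphere impedance `Z` given by the lumped formula
`3/(Z+Z_M) = 1/(Z_L+Z_M) + 2/(Z_S+Z_M)`. -/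
noncomputable def Zsphere (ZM ZL ZS : ℂ) : ℂ :=
  3 / (1 / (ZL + ZM) + 2 / (ZS + ZM)) - ZM

lemma radial_fderiv (φ : ℝ → ℂ) (φ' : ℂ) (y : EuclideanSpace ℝ (Fin 3)) (hy : y ≠ 0)
    (hφ : HasDerivAt φ φ' ‖y‖) :
    ∃ L : EuclideanSpace ℝ (Fin 3) →L[ℝ] ℂ, HasFDerivAt (fun z => φ ‖z‖) L y ∧
      ∀ j, L (EuclideanSpace.single j 1) = (y j : ℂ) * (φ' / (‖y‖ : ℂ)) := by
  have hn : ‖y‖ ≠ 0 := norm_ne_zero_iff.mpr hy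
  have h1 : HasFDerivAt (fun z : EuclideanSpace ℝ (Fin 3) => ‖z‖ ^ 2) (2 • innerSL ℝ y) y :=
    (hasStrictFDerivAt_norm_sq y).hasFDerivAt
  have h2 := h1.sqrt (pow_ne_zero 2 hn)
  have h3 : HasFDerivAt (fun z : EuclideanSpace ℝ (Fin 3) => ‖z‖)
      ((1 / (2 * √(‖y‖ ^ 2))) • (2 • innerSL ℝ y)) y := by
    refine h2.congr_of_eventuallyEq (Eventually.of_forall fun z => ?_)
    simp [Real.sqrt_sq (norm_nonneg z)]
  refine ⟨_, hφ.hasFDerivAt.comp y h3, fun j => ?_⟩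
  have hc : (‖y‖ : ℂ) ≠ 0 := by exact_mod_cast hn
  have hi : inner ℝ y (EuclideanSpace.single j (1 : ℝ)) = y j := by
    simp [EuclideanSpace.inner_single_right]
  simp [Real.sqrt_sq (norm_nonneg y), hi]
  field_simp

lemma hess_entry (k h : ℝ) (hh : h ≠ 0) (x : EuclideanSpace ℝ (Fin 3)) (hx : x ≠ 0)
    (i j : Fin 3) :
    fderiv ℝ (fun y => fderiv ℝ (fun y : EuclideanSpace ℝ (Fin 3) =>
      (Complex.exp (I * h * (‖y‖ : ℝ)) - Complex.exp (I * k * (‖y‖ : ℝ)))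
      / ((h : ℂ) ^ 2 * (‖y‖ : ℂ))) y (EuclideanSpace.single j 1)) x (EuclideanSpace.single i 1)
    = (if i = j then 1 else 0) * ((Complex.exp (I * h * (‖x‖ : ℝ)) * (I * h * ‖x‖ - 1)
        - Complex.exp (I * k * (‖x‖ : ℝ)) * (I * k * ‖x‖ - 1)) / ((h : ℂ) ^ 2 * (‖x‖ : ℂ) ^ 3))
      + (x j : ℂ) * ((x i : ℂ) * (((-h ^ 2 * Complex.exp (I * h * (‖x‖ : ℝ))
          + k ^ 2 * Complex.exp (I * k * (‖x‖ : ℝ))) / ((h : ℂ) ^ 2 * (‖x‖ : ℂ) ^ 2)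
          - 3 * (Complex.exp (I * h * (‖x‖ : ℝ)) * (I * h * ‖x‖ - 1)
        - Complex.exp (I * k * (‖x‖ : ℝ)) * (I * k * ‖x‖ - 1)) / ((h : ℂ) ^ 2 * (‖x‖ : ℂ) ^ 4))
          / (‖x‖ : ℂ))) := by
  have hhc : (h : ℂ) ≠ 0 := by exact_mod_cast hh
  have hE : ∀ (c r : ℝ), HasDerivAt (fun r : ℝ => Complex.exp (I * c * (r : ℂ)))
      (Complex.exp (I * c * (r : ℂ)) * (I * c)) r := by
    intro c r
    have := ((Complex.ofRealCLM.hasDerivAt (x := r)).const_mul (I * (c : ℂ))).cexp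
    simpa using this
  have hid : ∀ r : ℝ, HasDerivAt (fun r : ℝ => (r : ℂ)) 1 r := fun r => by
    exact (Complex.ofRealCLM.hasDerivAt (x := r)).congr_deriv (by simp)
  set ψ : ℝ → ℂ := fun r => (Complex.exp (I * h * (r : ℂ)) * (I * h * r - 1)
        - Complex.exp (I * k * (r : ℂ)) * (I * k * r - 1)) / ((h : ℂ) ^ 2 * (r : ℂ) ^ 3) with hψ
  have hfst : ∀ y : EuclideanSpace ℝ (Fin 3), y ≠ 0 →
      fderiv ℝ (fun y : EuclideanSpace ℝ (Fin 3) =>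
      (Complex.exp (I * h * (‖y‖ : ℝ)) - Complex.exp (I * k * (‖y‖ : ℝ)))
      / ((h : ℂ) ^ 2 * (‖y‖ : ℂ))) y (EuclideanSpace.single j 1) = (y j : ℂ) * ψ ‖y‖ := by
    intro y hy
    have hc : (‖y‖ : ℂ) ≠ 0 := by exact_mod_cast norm_ne_zero_iff.mpr hy
    have hd := ((hE h ‖y‖).sub (hE k ‖y‖)).div ((hid ‖y‖).const_mul ((h : ℂ) ^ 2))
      (mul_ne_zero (pow_ne_zero 2 hhc) hc)
    obtain ⟨L, hL, hLj⟩ := radial_fderiv _ _ y hy hd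
    have hL' := hL.fderiv
    simp only [Pi.sub_apply, Pi.div_apply] at hL'
    rw [hL', hLj, hψ]
    simp only [Pi.sub_apply]
    field_simp
    ring
  have hev : (fun y => fderiv ℝ (fun y : EuclideanSpace ℝ (Fin 3) =>
      (Complex.exp (I * h * (‖y‖ : ℝ)) - Complex.exp (I * k * (‖y‖ : ℝ)))
      / ((h : ℂ) ^ 2 * (‖y‖ : ℂ))) y (EuclideanSpace.single j 1)) =ᶠ[𝓝 x]
      fun y => (y j : ℂ) * ψ ‖y‖ := by
    filter_upwards [isOpen_ne.mem_nhds hx] with y hy using hfst y hy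
  rw [hev.fderiv_eq]
  have hc : (‖x‖ : ℂ) ≠ 0 := by exact_mod_cast norm_ne_zero_iff.mpr hx
  have hT : ∀ c : ℝ, HasDerivAt (fun r : ℝ => Complex.exp (I * c * (r : ℂ)) * (I * c * r - 1))
      (-c ^ 2 * ‖x‖ * Complex.exp (I * c * ‖x‖)) ‖x‖ := by
    intro c
    refine ((hE c ‖x‖).mul (((hid ‖x‖).const_mul (I * (c : ℂ))).sub_const 1)).congr_deriv ?_
    linear_combination (Complex.exp (I * c * ‖x‖) * c ^ 2 * ‖x‖) * I_sq
  have hd := ((hT h).sub (hT k)).div (((hid ‖x‖).pow 3).const_mul ((h : ℂ) ^ 2))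
      (mul_ne_zero (pow_ne_zero 2 hhc) (pow_ne_zero 3 hc))
  obtain ⟨L, hL, hLj⟩ := radial_fderiv ψ _ x hx hd
  have hp : HasFDerivAt (fun y : EuclideanSpace ℝ (Fin 3) => ((y j : ℝ) : ℂ))
      (Complex.ofRealCLM.comp (EuclideanSpace.proj j)) x :=
    (Complex.ofRealCLM.comp (EuclideanSpace.proj j)).hasFDerivAt
  have hfin : fderiv ℝ (fun y : EuclideanSpace ℝ (Fin 3) => (y j : ℂ) * ψ ‖y‖) x = _ :=
    (hp.mul hL).fderiv
  rw [hfin]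
  simp only [_root_.add_apply, _root_.smul_apply, hLj, smul_eq_mul,
    ContinuousLinearMap.comp_apply, Complex.ofRealCLM_apply,
    Pi.sub_apply, Pi.pow_apply, hψ]
  have hs : (((EuclideanSpace.proj j : EuclideanSpace ℝ (Fin 3) →L[ℝ] ℝ)
      (EuclideanSpace.single i (1 : ℝ)) : ℝ) : ℂ)
      = if i = j then 1 else 0 := by
    by_cases hij : i = j
    · simp [hij]
    · simp [hij, Ne.symm hij]
  rw [hs]
  generalize (if i = j then (1 : ℂ) else 0) = d
  field_simp
  ring

lemma final_alg (k h m M R d xi xj Eh Ek J p : ℂ) (hk : k ≠ 0) (hh : h ≠ 0) (hm : m ≠ 0)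
    (hM0 : M ≠ 0) (hR : R ≠ 0) (hp : p ≠ 0) (hM : k ^ 2 * M = h ^ 2 * m) (hs : 2 * M + m ≠ 0) :
    3 / (1 / M + 2 / m) / R * (Ek / M * ((1 / (k * R) ^ 2 - J / (k * R)) * d
          + (1 + 3 * J / (k * R) - 3 / (k * R) ^ 2) * (xi / R * (xj / R)))
        + Eh / m * ((1 + J / (h * R) - 1 / (h * R) ^ 2) * d
          - (1 + 3 * J / (h * R) - 3 / (h * R) ^ 2) * (xi / R * (xj / R))))
    = 12 * p * m / (2 + m / M) * (1 / (4 * p * m) * (Eh / R * d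
      + (d * ((Eh * (J * h * R - 1) - Ek * (J * k * R - 1)) / (h ^ 2 * R ^ 3))
      + xj * (xi * (((-h ^ 2 * Eh + k ^ 2 * Ek) / (h ^ 2 * R ^ 2)
          - 3 * (Eh * (J * h * R - 1) - Ek * (J * k * R - 1)) / (h ^ 2 * R ^ 4)) / R))))) := by
  have e1 : 3 / (1 / M + 2 / m) = 3 * M * m / (2 * M + m) := by
    have : 1 / M + 2 / m = (2 * M + m) / (M * m) := by field_simp; ring
    rw [this]; field_simp
  have e2 : 12 * p * m / (2 + m / M) = 12 * p * m * M / (2 * M + m) := by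
    have : 2 + m / M = (2 * M + m) / M := by field_simp
    rw [this]; field_simp
  have e3 : m = k ^ 2 * M / h ^ 2 := by rw [hM]; field_simp
  rw [e1, e2]
  generalize 2 * M + m = S at hs
  subst e3
  field_simp
  ring

theorem small_inclusion_limit (ρ lam mu ω : ℝ)
    (hρ : 0 < ρ) (hmu : 0 < mu) (hlam : 0 < lam + 2 * mu) (hω : 0 < ω)
    (k h : ℝ)
    (hk : k = ω / Real.sqrt ((lam + 2 * mu) / ρ)) (hh : h = ω / Real.sqrt (mu / ρ))
    (x : EuclideanSpace ℝ (Fin 3)) (hx : x ≠ 0) :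
    Tendsto (fun a : ℝ => ((a : ℂ))⁻¹ •
        Udisp a k h (Zsphere (ZMf a ρ ω) (ZLf a ρ lam mu ω) (ZTf a ρ mu ω))
          (ZMf a ρ ω) (ZLf a ρ lam mu ω) (ZTf a ρ mu ω) (ZTf a ρ mu ω) x)
      (𝓝[>] 0)
      (𝓝 ((((12 * Real.pi * mu : ℝ) / (2 + (mu / (lam + 2 * mu) : ℝ)) : ℝ) : ℂ) •
            Green0 k h mu x)) := by
  have hcL : 0 < (lam + 2 * mu) / ρ := div_pos hlam hρ
  have hcT : 0 < mu / ρ := div_pos hmu hρ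
  have hk0 : 0 < k := hk ▸ div_pos hω (Real.sqrt_pos.mpr hcL)
  have hh0 : 0 < h := hh ▸ div_pos hω (Real.sqrt_pos.mpr hcT)
  have hk2 : k ^ 2 * (lam + 2 * mu) = ω ^ 2 * ρ := by
    rw [hk, div_pow, Real.sq_sqrt hcL.le]; field_simp
  have hh2 : h ^ 2 * mu = ω ^ 2 * ρ := by
    rw [hh, div_pow, Real.sq_sqrt hcT.le]; field_simp
  have hkh : k ^ 2 * (lam + 2 * mu) = h ^ 2 * mu := hk2.trans hh2.symm
  have hkhc : (k : ℂ) ^ 2 * (lam + 2 * mu) = (h : ℂ) ^ 2 * mu := by exact_mod_cast hkh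
  have hkc : (k : ℂ) ≠ 0 := by exact_mod_cast hk0.ne'
  have hhc : (h : ℂ) ≠ 0 := by exact_mod_cast hh0.ne'
  have hωc : (ω : ℂ) ≠ 0 := by exact_mod_cast hω.ne'
  have hmuc : (mu : ℂ) ≠ 0 := by exact_mod_cast hmu.ne'
  have hlc : (lam : ℂ) + 2 * mu ≠ 0 := by exact_mod_cast hlam.ne'
  have hπ : (Real.pi : ℂ) ≠ 0 := by exact_mod_cast Real.pi_ne_zero
  have hc : (‖x‖ : ℂ) ≠ 0 := by exact_mod_cast norm_ne_zero_iff.mpr hx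
  have hsum : (2 : ℂ) * (lam + 2 * mu) + mu ≠ 0 := by
    have : (2 : ℝ) * (lam + 2 * mu) + mu ≠ 0 := by positivity
    exact_mod_cast this
  -- normalised impedances
  set A : ℝ → ℂ := fun a => (lam + 2 * mu) * (1 - I * k * a) - ω ^ 2 * a ^ 2 * ρ / 3 with hA
  set B : ℝ → ℂ := fun a => mu * (1 - I * h * a) - ω ^ 2 * a ^ 2 * ρ / 3 with hB
  have hAt : Tendsto A (𝓝[>] 0) (𝓝 (lam + 2 * mu)) := by
    have : Continuous A := by rw [hA]; fun_prop
    have := (this.tendsto 0).mono_left (nhdsWithin_le_nhds (s := Set.Ioi 0))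
    simpa [hA] using this
  have hBt : Tendsto B (𝓝[>] 0) (𝓝 (mu : ℂ)) := by
    have : Continuous B := by rw [hB]; fun_prop
    have := (this.tendsto 0).mono_left (nhdsWithin_le_nhds (s := Set.Ioi 0))
    simpa [hB] using this
  have hEt : ∀ c : ℝ, Tendsto (fun a : ℝ => Complex.exp (I * c * ((‖x‖ : ℝ) - a))) (𝓝[>] 0)
      (𝓝 (Complex.exp (I * c * (‖x‖ : ℝ)))) := by
    intro c
    have : Continuous (fun a : ℝ => Complex.exp (I * c * ((‖x‖ : ℝ) - a))) := by fun_prop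
    have := (this.tendsto 0).mono_left (nhdsWithin_le_nhds (s := Set.Ioi 0))
    simpa using this
  have hW : Tendsto (fun a => 3 / (1 / A a + 2 / B a)) (𝓝[>] 0)
      (𝓝 (3 / (1 / (lam + 2 * mu) + 2 / mu))) := by
    refine tendsto_const_nhds.div ((tendsto_const_nhds.div hAt hlc).add
      (tendsto_const_nhds.div hBt hmuc)) ?_
    have : (1 : ℂ) / (lam + 2 * mu) + 2 / mu = (2 * (lam + 2 * mu) + mu) / ((lam + 2 * mu) * mu) := by
      field_simp; ring
    rw [this]
    exact div_ne_zero hsum (mul_ne_zero hlc hmuc)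
  refine tendsto_pi_nhds.mpr fun i => tendsto_pi_nhds.mpr fun j => ?_
  set δ : ℂ := if i = j then 1 else 0 with hδ
  have hone : (1 : Matrix (Fin 3) (Fin 3) ℂ) i j = δ := by simp [hδ, Matrix.one_apply]
  set P : ℂ := (1 / ((k : ℂ) * ‖x‖) ^ 2 - I / ((k : ℂ) * ‖x‖)) * δ
          + (1 + 3 * I / ((k : ℂ) * ‖x‖) - 3 / ((k : ℂ) * ‖x‖) ^ 2) * outerUnit x i j with hP
  set Q : ℂ := (1 + I / ((h : ℂ) * ‖x‖) - 1 / ((h : ℂ) * ‖x‖) ^ 2) * δ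
          - (1 + 3 * I / ((h : ℂ) * ‖x‖) - 3 / ((h : ℂ) * ‖x‖) ^ 2) * outerUnit x i j with hQ
  have hlim := (hW.div_const (‖x‖ : ℂ)).mul
    ((((hEt k).div hAt hlc).mul_const P).add (((hEt h).div hBt hmuc).mul_const Q))
  refine (hlim.congr' ?_).trans (le_of_eq (congrArg 𝓝 ?_))
  · filter_upwards [self_mem_nhdsWithin] with a ha
    have ha0 : (a : ℂ) ≠ 0 := by
      have : (0 : ℝ) < a := ha
      exact_mod_cast this.ne'
    set s : ℂ := I * ω / (4 * Real.pi * a) with hs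
    have hs0 : s ≠ 0 := by
      rw [hs]; exact div_ne_zero (mul_ne_zero I_ne_zero hωc) (by simp [hπ, ha0])
    have e1 : ZLf a ρ lam mu ω + ZMf a ρ ω = A a / s := by
      have hkk : (ω : ℂ) / ((Real.sqrt ((lam + 2 * mu) / ρ) : ℝ) : ℂ) = k := by rw [hk]; push_cast; rfl
      rw [eq_div_iff hs0, hA, hs, ZLf, ZMf, hkk]
      field_simp
      linear_combination (a ^ 2 * ω ^ 2 * ρ : ℂ) * I_sq
    have e2 : ZTf a ρ mu ω + ZMf a ρ ω = B a / s := by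
      have hkk : (ω : ℂ) / ((Real.sqrt (mu / ρ) : ℝ) : ℂ) = h := by rw [hh]; push_cast; rfl
      rw [eq_div_iff hs0, hB, hs, ZTf, ZMf, hkk]
      field_simp
      linear_combination (a ^ 2 * ω ^ 2 * ρ : ℂ) * I_sq
    have e3 : ZTf a ρ mu ω ≠ 0 := by
      have hkk : (ω : ℂ) / ((Real.sqrt (mu / ρ) : ℝ) : ℂ) = h := by rw [hh]; push_cast; rfl
      have h1 : (1 : ℂ) - I * h * a ≠ 0 := by
        intro h0
        have := congrArg Complex.re h0
        simp at this
      rw [ZTf, hkk]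
      exact mul_ne_zero (mul_ne_zero (inv_ne_zero (mul_ne_zero I_ne_zero hωc))
        (by simp [hπ, ha0, hmuc])) h1
    have e4 : Zsphere (ZMf a ρ ω) (ZLf a ρ lam mu ω) (ZTf a ρ mu ω) + ZMf a ρ ω
        = 3 / (1 / A a + 2 / B a) / s := by
      rw [Zsphere, e1, e2, sub_add_cancel, div_div]
      congr 1
      rw [one_div_div, div_div_eq_mul_div]
      ring
    clear_value s
    simp only [Udisp, Matrix.smul_apply, Matrix.add_apply, Matrix.sub_apply, smul_eq_mul, hone]
    rw [e4, e1, e2, div_self e3, ← hP, ← hQ, one_mul, div_div_eq_mul_div, div_div_eq_mul_div]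
    generalize 3 / (1 / A a + 2 / B a) = W
    simp only [Pi.div_apply]
    field_simp
  · simp only [Green0, Matrix.smul_apply, Matrix.add_apply, smul_eq_mul, hone, Matrix.of_apply]
    rw [hess_entry k h hh0.ne' x hx i j, ← hδ, hP, hQ]
    simp only [outerUnit, Matrix.of_apply]
    push_cast
    exact final_alg k h mu (lam + 2 * mu) ‖x‖ δ (x i) (x j) _ _ I Real.pi hkc hhc hmuc hlc hc hπ
      hkhc hsum
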